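/- Let ν > −1 be such that the first positive zero j_{ν,1} of J_ν satisfies j_{ν,1} > 1. Then the entire function g_ν(z) = 2^ν Γ(ν+1) z^{1−ν} J_ν(z) has no zeros in the closed unit disk except 0, and for every z in the open unit disk 𝔻 ∖ {0} one has Re( z·g_ν′(z)/g_ν(z) ) ≥ 1 − J_{ν+1}(1)/J_ν(1). -/

import Mathlib

open Complex Metric Set Filter

/-- The Bessel function of the first kind `J_ν`, defined on `ℂ` via the principal
branch of the power `(z/2)^(2n+ν)`. -/
noncomputable def besselJ (ν : ℝ) (z : ℂ) : ℂ :=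
  ∑' n : ℕ, (((-1) ^ n / (n.factorial * Real.Gamma (n + ν + 1)) : ℝ) : ℂ) *
    (z / 2) ^ ((2 * n + ν : ℝ) : ℂ)

/-- The entire function `g_ν(z) = 2^ν Γ(ν+1) z^(1-ν) J_ν(z)`, given by its power series. -/
noncomputable def besselG (ν : ℝ) (z : ℂ) : ℂ :=
  ∑' n : ℕ, (((-1) ^ n * Real.Gamma (ν + 1) /
      (4 ^ n * n.factorial * Real.Gamma (n + ν + 1)) : ℝ) : ℂ) * z ^ (2 * n + 1)

/-- The sum of the power series with coefficients `a`. -/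
noncomputable def powSum {𝕜 : Type*} [RCLike 𝕜] (a : ℕ → 𝕜) (z : 𝕜) : 𝕜 :=
  ∑' n, a n * z ^ n

/-- The coefficients of the termwise derivative of a power series. -/
def derivCoeff {𝕜 : Type*} [RCLike 𝕜] (a : ℕ → 𝕜) (n : ℕ) : 𝕜 :=
  (n + 1) * a (n + 1)

/-- The power series with coefficients `a` converges absolutely everywhere. -/
def IsEntireCoeff {𝕜 : Type*} [RCLike 𝕜] (a : ℕ → 𝕜) : Prop :=
  ∀ r : ℝ, 0 ≤ r → Summable fun n => ‖a n‖ * r ^ n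

section PowSum

variable {𝕜 : Type*} [RCLike 𝕜] {a : ℕ → 𝕜}

lemma IsEntireCoeff.summable_norm (h : IsEntireCoeff a) (z : 𝕜) :
    Summable fun n => ‖a n * z ^ n‖ := by
  simpa only [norm_mul, norm_pow] using h ‖z‖ (norm_nonneg z)

lemma IsEntireCoeff.summable (h : IsEntireCoeff a) (z : 𝕜) :
    Summable fun n => a n * z ^ n :=
  (h.summable_norm z).of_norm

lemma IsEntireCoeff.derivCoeff (h : IsEntireCoeff a) : IsEntireCoeff (derivCoeff a) := by
  intro r hr
  refine Summable.of_nonneg_of_le (fun n => by positivity) (fun n => ?_)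
    ((summable_nat_add_iff 1).2 (h (2 * (r + 1)) (by positivity)))
  have h1 : ‖((n : 𝕜) + 1)‖ ≤ 2 ^ (n + 1) := by
    have : ‖((n : 𝕜) + 1)‖ = ((n + 1 : ℕ) : ℝ) := by
      rw [← RCLike.norm_natCast (K := 𝕜) (n + 1)]
      push_cast
      rfl
    rw [this]
    exact_mod_cast (Nat.lt_two_pow_self (n := n + 1)).le
  have h2 : r ^ n ≤ (r + 1) ^ (n + 1) :=
    calc r ^ n ≤ (r + 1) ^ n := by gcongr; linarith
      _ ≤ (r + 1) ^ (n + 1) := pow_le_pow_right₀ (by linarith) (Nat.le_succ n)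
  calc ‖_root_.derivCoeff a n‖ * r ^ n = ‖a (n + 1)‖ * (‖((n : 𝕜) + 1)‖ * r ^ n) := by
        rw [_root_.derivCoeff, norm_mul]; ring
    _ ≤ ‖a (n + 1)‖ * (2 ^ (n + 1) * (r + 1) ^ (n + 1)) := by gcongr
    _ = ‖a (n + 1)‖ * (2 * (r + 1)) ^ (n + 1) := by rw [mul_pow]

lemma IsEntireCoeff.hasDerivAt (h : IsEntireCoeff a) (z : 𝕜) :
    HasDerivAt (powSum a) (powSum (_root_.derivCoeff a) z) z := by
  set R : ℝ := ‖z‖ + 1 with hR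
  have hR1 : 1 ≤ R := by have := norm_nonneg z; linarith
  have hzR : z ∈ Metric.ball (0 : 𝕜) R := by simp [hR]
  have hbound : ∀ n : ℕ, ∀ y ∈ Metric.ball (0 : 𝕜) R,
      ‖a n * (n * y ^ (n - 1))‖ ≤ ‖a n‖ * (2 * R) ^ n := by
    intro n y hy
    rw [mem_ball_zero_iff] at hy
    have h1 : (n : ℝ) ≤ 2 ^ n := by exact_mod_cast (Nat.lt_two_pow_self (n := n)).le
    have h2 : ‖y‖ ^ (n - 1) ≤ R ^ n :=
      calc ‖y‖ ^ (n - 1) ≤ R ^ (n - 1) := by gcongr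
        _ ≤ R ^ n := pow_le_pow_right₀ hR1 (Nat.sub_le n 1)
    rw [norm_mul, norm_mul, norm_pow, RCLike.norm_natCast, mul_pow]
    gcongr
  have hd := hasDerivAt_tsum_of_isPreconnected (h (2 * R) (by positivity)) Metric.isOpen_ball
    (convex_ball (0 : 𝕜) R).isPreconnected
    (fun n y _ => (hasDerivAt_pow n y).const_mul (a n)) hbound hzR (h.summable z) hzR
  have hs : Summable fun n : ℕ => a n * (n * z ^ (n - 1)) :=
    Summable.of_norm_bounded (h (2 * R) (by positivity)) fun n => hbound n z hzR
  have he : powSum (_root_.derivCoeff a) z = ∑' n : ℕ, a n * (n * z ^ (n - 1)) := by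
    rw [hs.tsum_eq_zero_add, powSum]
    simp only [Nat.cast_zero, zero_mul, mul_zero, zero_add]
    refine tsum_congr fun n => ?_
    simp only [_root_.derivCoeff, Nat.add_sub_cancel, Nat.cast_add, Nat.cast_one]
    ring
  rw [he]
  exact hd

lemma powSum_zero (a : ℕ → 𝕜) : powSum a 0 = a 0 := by
  rw [powSum, tsum_eq_single 0]
  · simp
  · intro n hn
    simp [hn]

end PowSum

/-- The Taylor coefficients of `∑ (-1)ⁿ Γ(ν+1) / (4ⁿ n! Γ(n+ν+1)) wⁿ`, the function whose
value at `z²` is `g_ν(z) / z`. -/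
noncomputable def besselCoeff (ν : ℝ) (n : ℕ) : ℝ :=
  (-1) ^ n * Real.Gamma (ν + 1) / (4 ^ n * n.factorial * Real.Gamma (n + ν + 1))

section Coefficients

variable {ν : ℝ}

lemma natCast_add_pos (hν : -1 < ν) (n : ℕ) : 0 < (n : ℝ) + ν + 1 := by
  have : (0 : ℝ) ≤ n := n.cast_nonneg
  linarith

lemma besselCoeff_zero (hν : -1 < ν) : besselCoeff ν 0 = 1 := by
  have : Real.Gamma (ν + 1) ≠ 0 := (Real.Gamma_pos_of_pos (by linarith)).ne'
  simp [besselCoeff, this]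

lemma besselCoeff_succ (hν : -1 < ν) (n : ℕ) :
    (n + 1) * (n + ν + 1) * besselCoeff ν (n + 1) = -(besselCoeff ν n) / 4 := by
  have h0 := natCast_add_pos hν n
  have hG : Real.Gamma (n + ν + 1) ≠ 0 := (Real.Gamma_pos_of_pos h0).ne'
  have hs : Real.Gamma (((n + 1 : ℕ) : ℝ) + ν + 1) = (n + ν + 1) * Real.Gamma (n + ν + 1) := by
    rw [← Real.Gamma_add_one h0.ne']
    congr 1
    push_cast
    ring
  have hn : (n : ℝ) + 1 ≠ 0 := by positivity
  have hf : (n.factorial : ℝ) ≠ 0 := by positivity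
  have h0' := h0.ne'
  rw [besselCoeff, besselCoeff, hs, Nat.factorial_succ]
  push_cast
  field_simp
  ring

lemma abs_besselCoeff_le (hν : -1 < ν) (n : ℕ) :
    |besselCoeff ν n| ≤ (1 / (4 * (ν + 1))) ^ n / n.factorial := by
  have hν' : 0 < ν + 1 := by linarith
  induction n with
  | zero => simp [besselCoeff_zero hν]
  | succ n ih =>
    have h0 := natCast_add_pos hν n
    have hn : 0 < (n : ℝ) + 1 := by positivity
    have e : besselCoeff ν (n + 1) = -(besselCoeff ν n) / (4 * ((n + 1) * (n + ν + 1))) := by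
      rw [eq_div_iff (by positivity)]
      linear_combination 4 * besselCoeff_succ hν n
    rw [e, abs_div, abs_neg, abs_of_pos (by positivity : 0 < 4 * (((n : ℝ) + 1) * (n + ν + 1))),
      Nat.factorial_succ, pow_succ]
    push_cast
    calc |besselCoeff ν n| / (4 * ((n + 1) * (n + ν + 1)))
        ≤ ((1 / (4 * (ν + 1))) ^ n / n.factorial) / (4 * ((n + 1) * (ν + 1))) := by
          gcongr
          have : (0 : ℝ) ≤ n := n.cast_nonneg
          linarith
      _ = (1 / (4 * (ν + 1))) ^ n * (1 / (4 * (ν + 1))) / ((n + 1) * n.factorial) := by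
          field_simp

lemma isEntireCoeff_besselCoeff (hν : -1 < ν) : IsEntireCoeff (besselCoeff ν) := by
  intro r hr
  have hν' : 0 < ν + 1 := by linarith
  refine Summable.of_nonneg_of_le (fun n => by positivity) (fun n => ?_)
    (Real.summable_pow_div_factorial (1 / (4 * (ν + 1)) * r))
  rw [mul_pow, mul_div_right_comm]
  gcongr
  exact abs_besselCoeff_le hν n

lemma isEntireCoeff_ofReal {a : ℕ → ℝ} (h : IsEntireCoeff a) :
    IsEntireCoeff fun n => (a n : ℂ) := by
  intro r hr
  simpa using h r hr

lemma derivCoeff_ofReal (a : ℕ → ℝ) :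
    derivCoeff (fun n => (a n : ℂ)) = fun n => ((derivCoeff a n : ℝ) : ℂ) := by
  ext n
  simp [derivCoeff]

lemma powSum_ofReal (a : ℕ → ℝ) (x : ℝ) :
    powSum (fun n => (a n : ℂ)) x = ((powSum a x : ℝ) : ℂ) := by
  simp only [powSum, Complex.ofReal_tsum, Complex.ofReal_mul, Complex.ofReal_pow]

end Coefficients

/-- The Bessel equation for `f = powSum (besselCoeff ν)`. -/
lemma besselCoeff_ode {ν : ℝ} (hν : -1 < ν) (x : ℝ) :
    x * powSum (derivCoeff (derivCoeff (besselCoeff ν))) x +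
      (ν + 1) * powSum (derivCoeff (besselCoeff ν)) x + powSum (besselCoeff ν) x / 4 = 0 := by
  have h := isEntireCoeff_besselCoeff hν
  set c := besselCoeff ν
  have hs : Summable fun n : ℕ => n * derivCoeff c n * x ^ n := by
    rw [← summable_nat_add_iff 1]
    refine ((h.derivCoeff.derivCoeff.summable x).mul_left x).congr fun n => ?_
    simp only [derivCoeff]
    push_cast
    ring
  have hx : x * powSum (derivCoeff (derivCoeff c)) x = ∑' n : ℕ, n * derivCoeff c n * x ^ n := by
    rw [hs.tsum_eq_zero_add, powSum, ← tsum_mul_left]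
    simp only [Nat.cast_zero, zero_mul, zero_add]
    refine tsum_congr fun n => ?_
    simp only [derivCoeff]
    push_cast
    ring
  rw [hx, powSum, powSum, ← tsum_mul_left, ← tsum_div_const,
    ← hs.tsum_add ((h.derivCoeff.summable x).mul_left _),
    ← (hs.add ((h.derivCoeff.summable x).mul_left _)).tsum_add ((h.summable x).div_const 4)]
  convert tsum_zero with n
  simp only [derivCoeff]
  linear_combination x ^ n * besselCoeff_succ hν n

/-- The Rayleigh coefficients: the formal power series coefficients of the negative logarithmic
derivative of `f = ∑ besselCoeff ν n wⁿ`. -/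
noncomputable def rayleighCoeff (ν : ℝ) (n : ℕ) : ℝ :=
  PowerSeries.coeff n
    (-(PowerSeries.derivative ℝ (PowerSeries.mk (besselCoeff ν)) *
      (PowerSeries.mk (besselCoeff ν))⁻¹))

section Rayleigh

variable {ν : ℝ}

lemma rayleighSeries_mul (hν : -1 < ν) :
    PowerSeries.mk (rayleighCoeff ν) * PowerSeries.mk (besselCoeff ν) =
      -PowerSeries.derivative ℝ (PowerSeries.mk (besselCoeff ν)) := by
  have hU : PowerSeries.mk (rayleighCoeff ν) =
      -(PowerSeries.derivative ℝ (PowerSeries.mk (besselCoeff ν)) *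
        (PowerSeries.mk (besselCoeff ν))⁻¹) := by
    ext n
    simp [rayleighCoeff]
  have hc : PowerSeries.constantCoeff (PowerSeries.mk (besselCoeff ν)) ≠ 0 := by
    rw [← PowerSeries.coeff_zero_eq_constantCoeff_apply, PowerSeries.coeff_mk,
      besselCoeff_zero hν]
    exact one_ne_zero
  rw [hU, neg_mul, mul_assoc, PowerSeries.inv_mul_cancel _ hc, mul_one]

lemma derivCoeff_besselCoeff_eq (hν : -1 < ν) (n : ℕ) :
    derivCoeff (besselCoeff ν) n =
      -∑ p ∈ Finset.HasAntidiagonal.antidiagonal n, rayleighCoeff ν p.1 * besselCoeff ν p.2 := by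
  have h := congrArg (PowerSeries.coeff n) (rayleighSeries_mul hν)
  rw [PowerSeries.coeff_mul, map_neg, PowerSeries.coeff_derivative] at h
  simp only [PowerSeries.coeff_mk] at h
  rw [derivCoeff, h]
  ring

lemma rayleighSeries_riccati (hν : -1 < ν) :
    PowerSeries.X * PowerSeries.derivative ℝ (PowerSeries.mk (rayleighCoeff ν)) +
        PowerSeries.C (ν + 1) * PowerSeries.mk (rayleighCoeff ν) =
      PowerSeries.C (1 / 4) +
        PowerSeries.X * (PowerSeries.mk (rayleighCoeff ν) * PowerSeries.mk (rayleighCoeff ν)) := by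
  have hUF := rayleighSeries_mul hν
  have hode : PowerSeries.X *
        PowerSeries.derivative ℝ (PowerSeries.derivative ℝ (PowerSeries.mk (besselCoeff ν))) +
      PowerSeries.C (ν + 1) * PowerSeries.derivative ℝ (PowerSeries.mk (besselCoeff ν)) +
      PowerSeries.C (1 / 4) * PowerSeries.mk (besselCoeff ν) = 0 := by
    ext n
    have hc := besselCoeff_succ hν n
    cases n with
    | zero =>
      simp only [LinearMap.map_add, PowerSeries.coeff_zero_X_mul, PowerSeries.coeff_C_mul,
        PowerSeries.coeff_derivative, PowerSeries.coeff_mk, map_zero]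
      push_cast at hc ⊢
      linear_combination hc
    | succ n =>
      simp only [LinearMap.map_add, PowerSeries.coeff_succ_X_mul, PowerSeries.coeff_C_mul,
        PowerSeries.coeff_derivative, PowerSeries.coeff_mk, map_zero]
      push_cast at hc ⊢
      linear_combination hc
  have hF0 : PowerSeries.mk (besselCoeff ν) ≠ 0 := by
    intro h
    have := congrArg (PowerSeries.coeff 0) h
    simp [besselCoeff_zero hν] at this
  set F := PowerSeries.mk (besselCoeff ν)
  set U := PowerSeries.mk (rayleighCoeff ν)
  have hd := congrArg (PowerSeries.derivative ℝ) hUF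
  rw [Derivation.leibniz, map_neg, smul_eq_mul, smul_eq_mul] at hd
  refine mul_right_cancel₀ hF0 ?_
  have hF' : PowerSeries.derivative ℝ F = -(U * F) := by rw [hUF, neg_neg]
  linear_combination PowerSeries.X * hd + (PowerSeries.C (ν + 1)) * hUF - hode
    - PowerSeries.X * U * hF'

lemma rayleighCoeff_zero (hν : -1 < ν) : (ν + 1) * rayleighCoeff ν 0 = 1 / 4 := by
  have h := congrArg (PowerSeries.coeff 0) (rayleighSeries_riccati hν)
  simpa only [LinearMap.map_add, PowerSeries.coeff_zero_X_mul, PowerSeries.coeff_C_mul,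
    PowerSeries.coeff_mk, PowerSeries.coeff_zero_C, zero_add, add_zero] using h

lemma rayleighCoeff_succ (hν : -1 < ν) (n : ℕ) :
    (((n + 1 : ℕ) : ℝ) + ν + 1) * rayleighCoeff ν (n + 1) =
      ∑ p ∈ Finset.HasAntidiagonal.antidiagonal n, rayleighCoeff ν p.1 * rayleighCoeff ν p.2 := by
  have h := congrArg (PowerSeries.coeff (n + 1)) (rayleighSeries_riccati hν)
  rw [LinearMap.map_add, LinearMap.map_add, PowerSeries.coeff_succ_X_mul,
    PowerSeries.coeff_succ_X_mul, PowerSeries.coeff_C_mul, PowerSeries.coeff_derivative,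
    PowerSeries.coeff_mul, PowerSeries.coeff_C, if_neg n.succ_ne_zero, zero_add] at h
  simp only [PowerSeries.coeff_mk] at h
  rw [← h]
  push_cast
  ring

lemma rayleighCoeff_nonneg (hν : -1 < ν) (n : ℕ) : 0 ≤ rayleighCoeff ν n := by
  induction n using Nat.strong_induction_on with
  | _ n ih =>
    cases n with
    | zero =>
      have h := rayleighCoeff_zero hν
      have hν' : 0 < ν + 1 := by linarith
      exact (pos_of_mul_pos_right (by rw [h]; norm_num) hν'.le).le
    | succ n =>
      refine nonneg_of_mul_nonneg_right (a := ((n + 1 : ℕ) : ℝ) + ν + 1) ?_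
        (natCast_add_pos hν (n + 1))
      rw [rayleighCoeff_succ hν]
      refine Finset.sum_nonneg fun p hp => ?_
      have hp' := Finset.HasAntidiagonal.mem_antidiagonal.1 hp
      exact mul_nonneg (ih _ (by omega)) (ih _ (by omega))

end Rayleigh

/-- If `κ v + x dv/dx ≥ 0` on `(0, 1)` with `κ > 0`, then `v ≥ 0` on `(0, 1]`. -/
lemma nonneg_of_euler_nonneg {κ : ℝ} (hκ : 0 < κ) {v v' : ℝ → ℝ}
    (hc : ContinuousOn v (Set.Icc 0 1)) (hd : ∀ x ∈ Set.Ioo (0 : ℝ) 1, HasDerivAt v (v' x) x)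
    (h : ∀ x ∈ Set.Ioo (0 : ℝ) 1, 0 ≤ κ * v x + x * v' x) {x : ℝ} (hx : x ∈ Set.Ioc (0 : ℝ) 1) :
    0 ≤ v x := by
  have hder : ∀ y ∈ Set.Ioo (0 : ℝ) 1,
      HasDerivAt (fun t => t ^ κ * v t) (y ^ (κ - 1) * (κ * v y + y * v' y)) y := by
    intro y hy
    have h1 : y ^ κ = y ^ (κ - 1) * y := by
      rw [← Real.rpow_add_one hy.1.ne', sub_add_cancel]
    have h2 : y ^ (κ - 1) * (κ * v y + y * v' y) =
        κ * y ^ (κ - 1) * v y + y ^ κ * v' y := by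
      rw [h1]
      ring
    rw [h2]
    exact (Real.hasDerivAt_rpow_const (p := κ) (Or.inl hy.1.ne')).mul (hd y hy)
  have hmono : MonotoneOn (fun t => t ^ κ * v t) (Set.Icc (0 : ℝ) 1) := by
    refine monotoneOn_of_deriv_nonneg (convex_Icc 0 1) ?_ ?_ ?_
    · exact (Real.continuous_rpow_const hκ.le).continuousOn.mul hc
    · intro y hy
      rw [interior_Icc] at hy
      exact (hder y hy).differentiableAt.differentiableWithinAt
    · intro y hy
      rw [interior_Icc] at hy
      rw [(hder y hy).deriv]
      exact mul_nonneg (Real.rpow_nonneg hy.1.le _) (h y hy)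
  have h0 := hmono (Set.left_mem_Icc.2 zero_le_one) (Set.Ioc_subset_Icc_self hx) hx.1.le
  simp only [Real.zero_rpow hκ.ne', zero_mul] at h0
  exact nonneg_of_mul_nonneg_right h0 (Real.rpow_pos_of_pos hx.1 κ)

lemma sum_range_antidiagonal_le_sq {a : ℕ → ℝ} (ha : ∀ n, 0 ≤ a n) {x : ℝ} (hx : 0 ≤ x) (N : ℕ) :
    ∑ k ∈ Finset.range N,
        (∑ p ∈ Finset.HasAntidiagonal.antidiagonal k, a p.1 * a p.2) * x ^ k ≤
      (∑ k ∈ Finset.range N, a k * x ^ k) ^ 2 := by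
  have h1 : ∀ k, (∑ p ∈ Finset.HasAntidiagonal.antidiagonal k, a p.1 * a p.2) * x ^ k =
      ∑ i ∈ Finset.range (k + 1), (a i * x ^ i) * (a (k - i) * x ^ (k - i)) := by
    intro k
    rw [Finset.Nat.sum_antidiagonal_eq_sum_range_succ (fun i j => a i * a j), Finset.sum_mul]
    refine Finset.sum_congr rfl fun i hi => ?_
    have hik : i + (k - i) = k := Nat.add_sub_cancel' (Nat.lt_succ_iff.1 (Finset.mem_range.1 hi))
    calc a i * a (k - i) * x ^ k = a i * a (k - i) * x ^ (i + (k - i)) := by rw [hik]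
      _ = _ := by rw [pow_add]; ring
  simp only [h1]
  rw [Finset.sum_range_diag_flip N fun i j => (a i * x ^ i) * (a j * x ^ j), sq,
    Finset.sum_mul_sum]
  refine Finset.sum_le_sum fun i _ => ?_
  refine Finset.sum_le_sum_of_subset_of_nonneg (Finset.range_mono (Nat.sub_le N i)) ?_
  intro j _ _
  have := ha i
  have := ha j
  positivity

section UnitInterval

variable {ν : ℝ}

/-- The Riccati equation for the negative logarithmic derivative of
`f = powSum (besselCoeff ν)`. -/
lemma hasDerivAt_neg_logDeriv (hν : -1 < ν) {x : ℝ} (hx : powSum (besselCoeff ν) x ≠ 0) :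
    ∃ d, HasDerivAt (fun t => -(powSum (derivCoeff (besselCoeff ν)) t / powSum (besselCoeff ν) t))
        d x ∧
      (ν + 1) * -(powSum (derivCoeff (besselCoeff ν)) x / powSum (besselCoeff ν) x) + x * d =
        1 / 4 + x * (-(powSum (derivCoeff (besselCoeff ν)) x / powSum (besselCoeff ν) x)) ^ 2 := by
  have h := isEntireCoeff_besselCoeff hν
  refine ⟨_, ((h.derivCoeff.hasDerivAt x).div (h.hasDerivAt x) hx).neg, ?_⟩
  have hode := besselCoeff_ode hν x
  field_simp
  linear_combination (-4 * powSum (besselCoeff ν) x) * hode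

lemma sum_range_rayleighCoeff_le (hν : -1 < ν)
    (hpos : ∀ x ∈ Set.Icc (0 : ℝ) 1, 0 < powSum (besselCoeff ν) x) (N : ℕ) :
    ∀ x ∈ Set.Ioc (0 : ℝ) 1, ∑ k ∈ Finset.range N, rayleighCoeff ν k * x ^ k ≤
      -(powSum (derivCoeff (besselCoeff ν)) x / powSum (besselCoeff ν) x) := by
  have h := isEntireCoeff_besselCoeff hν
  have hκ : 0 < ν + 1 := by linarith
  set u : ℝ → ℝ :=
    fun t => -(powSum (derivCoeff (besselCoeff ν)) t / powSum (besselCoeff ν) t) with hu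
  have hex : ∀ x : ℝ, ∃ d, x ∈ Set.Icc (0 : ℝ) 1 →
      HasDerivAt u d x ∧ (ν + 1) * u x + x * d = 1 / 4 + x * u x ^ 2 := by
    intro x
    by_cases hx : x ∈ Set.Icc (0 : ℝ) 1
    · obtain ⟨d, hd⟩ := hasDerivAt_neg_logDeriv hν (hpos x hx).ne'
      exact ⟨d, fun _ => hd⟩
    · exact ⟨0, fun hx' => absurd hx' hx⟩
  choose u' hu' using hex
  have hcont : ContinuousOn u (Set.Icc 0 1) :=
    fun x hx => (hu' x hx).1.continuousAt.continuousWithinAt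
  induction N with
  | zero =>
    intro x hx
    rw [Finset.sum_range_zero]
    refine nonneg_of_euler_nonneg hκ hcont (fun y hy => (hu' y (Set.Ioo_subset_Icc_self hy)).1)
      (fun y hy => ?_) hx
    rw [(hu' y (Set.Ioo_subset_Icc_self hy)).2]
    have := hy.1
    positivity
  | succ N ih =>
    intro x hx
    have hS : ∀ y : ℝ, HasDerivAt
        (fun t => ∑ k ∈ Finset.range (N + 1), rayleighCoeff ν k * t ^ k)
        (∑ k ∈ Finset.range (N + 1), rayleighCoeff ν k * (k * y ^ (k - 1))) y := fun y =>
      HasDerivAt.fun_sum fun k _ => (hasDerivAt_pow k y).const_mul _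
    have hSeuler : ∀ y : ℝ, (ν + 1) * (∑ k ∈ Finset.range (N + 1), rayleighCoeff ν k * y ^ k) +
        y * (∑ k ∈ Finset.range (N + 1), rayleighCoeff ν k * (k * y ^ (k - 1))) =
        1 / 4 + y * ∑ k ∈ Finset.range N, (∑ p ∈ Finset.HasAntidiagonal.antidiagonal k,
          rayleighCoeff ν p.1 * rayleighCoeff ν p.2) * y ^ k := by
      intro y
      rw [Finset.mul_sum, Finset.mul_sum, ← Finset.sum_add_distrib, Finset.sum_range_succ',
        Finset.mul_sum, add_comm (1 / 4 : ℝ), ← rayleighCoeff_zero hν]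
      congr 1
      · refine Finset.sum_congr rfl fun k _ => ?_
        rw [← rayleighCoeff_succ hν, Nat.add_sub_cancel]
        push_cast
        ring
      · simp
    rw [← sub_nonneg]
    refine nonneg_of_euler_nonneg hκ (v := fun t => u t -
        ∑ k ∈ Finset.range (N + 1), rayleighCoeff ν k * t ^ k)
      (hcont.sub fun y _ => (hS y).continuousAt.continuousWithinAt)
      (fun y hy => (hu' y (Set.Ioo_subset_Icc_self hy)).1.sub (hS y)) (fun y hy => ?_) hx
    have h1 := (hu' y (Set.Ioo_subset_Icc_self hy)).2
    have h2 := hSeuler y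
    have h3 := sum_range_antidiagonal_le_sq (rayleighCoeff_nonneg hν) hy.1.le N
    have h4 : (∑ k ∈ Finset.range N, rayleighCoeff ν k * y ^ k) ^ 2 ≤ u y ^ 2 := by
      refine pow_le_pow_left₀ (Finset.sum_nonneg fun k _ => ?_) (ih y (Set.Ioo_subset_Ioc_self hy)) 2
      exact mul_nonneg (rayleighCoeff_nonneg hν k) (pow_nonneg hy.1.le k)
    have h5 := mul_le_mul_of_nonneg_left (h3.trans h4) hy.1.le
    linarith

lemma summable_rayleighCoeff (hν : -1 < ν)
    (hpos : ∀ x ∈ Set.Icc (0 : ℝ) 1, 0 < powSum (besselCoeff ν) x) :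
    Summable (rayleighCoeff ν) := by
  refine summable_of_sum_range_le (c := -(powSum (derivCoeff (besselCoeff ν)) 1 /
    powSum (besselCoeff ν) 1)) (rayleighCoeff_nonneg hν) fun N => ?_
  simpa using sum_range_rayleighCoeff_le hν hpos N 1 ⟨zero_lt_one, le_rfl⟩

end UnitInterval

section UnitDisk

variable {ν : ℝ}

lemma norm_rayleighCoeff_mul_pow_le (hν : -1 < ν) {w : ℂ} (hw : ‖w‖ ≤ 1) (n : ℕ) :
    ‖(rayleighCoeff ν n : ℂ) * w ^ n‖ ≤ rayleighCoeff ν n := by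
  have hn := rayleighCoeff_nonneg hν n
  rw [norm_mul, norm_pow, Complex.norm_real, Real.norm_of_nonneg hn]
  exact mul_le_of_le_one_right hn (pow_le_one₀ (norm_nonneg w) hw)

lemma powSum_derivCoeff_eq (hν : -1 < ν) (hs : Summable (rayleighCoeff ν)) {w : ℂ}
    (hw : ‖w‖ ≤ 1) :
    powSum (derivCoeff fun n => (besselCoeff ν n : ℂ)) w =
      -(powSum (fun n => (rayleighCoeff ν n : ℂ)) w *
        powSum (fun n => (besselCoeff ν n : ℂ)) w) := by
  have h := isEntireCoeff_ofReal (isEntireCoeff_besselCoeff hν)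
  have ha : Summable fun n => ‖(rayleighCoeff ν n : ℂ) * w ^ n‖ :=
    Summable.of_nonneg_of_le (fun n => norm_nonneg _)
      (norm_rayleighCoeff_mul_pow_le hν hw) hs
  rw [powSum, powSum, powSum,
    tsum_mul_tsum_eq_tsum_sum_antidiagonal_of_summable_norm ha (h.summable_norm w), ← tsum_neg]
  refine tsum_congr fun n => ?_
  rw [derivCoeff_ofReal]
  dsimp only
  rw [derivCoeff_besselCoeff_eq hν, Complex.ofReal_neg, Complex.ofReal_sum,
    neg_mul, Finset.sum_mul]
  congr 1
  refine Finset.sum_congr rfl fun p hp => ?_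
  have hp' := Finset.HasAntidiagonal.mem_antidiagonal.1 hp
  rw [← hp', pow_add]
  push_cast
  ring

lemma norm_powSum_rayleighCoeff_le (hν : -1 < ν) (hs : Summable (rayleighCoeff ν)) {w : ℂ}
    (hw : ‖w‖ ≤ 1) :
    ‖powSum (fun n => (rayleighCoeff ν n : ℂ)) w‖ ≤ ∑' n, rayleighCoeff ν n :=
  tsum_of_norm_bounded hs.hasSum (norm_rayleighCoeff_mul_pow_le hν hw)

lemma powSum_besselCoeff_ne_zero (hν : -1 < ν) (hs : Summable (rayleighCoeff ν)) {w : ℂ}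
    (hw : ‖w‖ ≤ 1) : powSum (fun n => (besselCoeff ν n : ℂ)) w ≠ 0 := by
  intro h0
  have h := isEntireCoeff_ofReal (isEntireCoeff_besselCoeff hν)
  set f := powSum fun n => (besselCoeff ν n : ℂ)
  set f' := powSum (derivCoeff fun n => (besselCoeff ν n : ℂ))
  have hd : ∀ t : ℝ, HasDerivAt (fun t : ℝ => f ((1 - t) * w)) (f' ((1 - t) * w) * (-1 * w)) t := by
    intro t
    have h1 : HasDerivAt (fun t : ℝ => (1 - (t : ℂ)) * w) (-1 * w) t :=
      ((Complex.ofRealCLM.hasDerivAt (x := t)).const_sub 1).mul_const w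
    exact (h.hasDerivAt ((1 - (t : ℂ)) * w)).comp t h1
  have hg := norm_le_gronwallBound_of_norm_deriv_right_le (δ := 0) (ε := 0) (a := 0) (b := 1)
    (K := ∑' n, rayleighCoeff ν n) (fun t _ => (hd t).continuousAt.continuousWithinAt)
    (fun t _ => (hd t).hasDerivWithinAt) (by simp [h0]) ?_ 1 ⟨zero_le_one, le_rfl⟩
  · have h1 : f 0 = 1 := by simp [f, powSum_zero, besselCoeff_zero hν]
    simp [gronwallBound_ε0_δ0, h1] at hg
    linarith
  · intro t ht
    have ht' : ‖(1 - (t : ℂ)) * w‖ ≤ 1 := by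
      have : ‖(1 - (t : ℂ))‖ ≤ 1 := by
        rw [← Complex.ofReal_one, ← Complex.ofReal_sub, Complex.norm_real, Real.norm_eq_abs,
          abs_le]
        constructor <;> linarith [ht.1, ht.2]
      rw [norm_mul]
      exact mul_le_one₀ this (norm_nonneg w) hw
    have hU := norm_powSum_rayleighCoeff_le hν hs ht'
    rw [show f' ((1 - t) * w) = _ from powSum_derivCoeff_eq hν hs ht', neg_one_mul, neg_mul_neg,
      norm_mul, norm_mul, add_zero]
    calc _ ≤ ‖powSum (fun n => (rayleighCoeff ν n : ℂ)) ((1 - t) * w)‖ * ‖f ((1 - t) * w)‖ :=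
          mul_le_of_le_one_right (by positivity) hw
      _ ≤ _ := by gcongr

end UnitDisk

section Bessel

variable {ν : ℝ}

lemma besselG_eq (ν : ℝ) (z : ℂ) :
    besselG ν z = z * powSum (fun n => (besselCoeff ν n : ℂ)) (z ^ 2) := by
  rw [besselG, powSum, ← tsum_mul_left]
  refine tsum_congr fun n => ?_
  rw [besselCoeff, ← pow_mul]
  ring

lemma hasDerivAt_besselG (hν : -1 < ν) (z : ℂ) :
    HasDerivAt (besselG ν) (powSum (fun n => (besselCoeff ν n : ℂ)) (z ^ 2) +
      z * (powSum (derivCoeff fun n => (besselCoeff ν n : ℂ)) (z ^ 2) * (2 * z))) z := by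
  have h := isEntireCoeff_ofReal (isEntireCoeff_besselCoeff hν)
  rw [show besselG ν = fun z => z * powSum (fun n => (besselCoeff ν n : ℂ)) (z ^ 2) from
    funext (besselG_eq ν)]
  have h2 : HasDerivAt (fun z : ℂ => z ^ 2) (2 * z) z := by simpa using hasDerivAt_pow 2 z
  have h3 := (hasDerivAt_id z).mul ((h.hasDerivAt (z ^ 2)).comp z h2)
  simp only [one_mul, id_eq, Function.comp_apply] at h3
  exact h3

lemma besselJ_term {x : ℝ} (hx : 0 < x) (μ : ℝ) (n : ℕ) :
    ((x : ℂ) / 2) ^ ((2 * n + μ : ℝ) : ℂ) = (((x / 2) ^ μ * ((x / 2) ^ 2) ^ n : ℝ) : ℂ) := by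
  have hx2 : 0 < x / 2 := by positivity
  have h1 : (x : ℂ) / 2 = ((x / 2 : ℝ) : ℂ) := by push_cast; rfl
  rw [h1, ← Complex.ofReal_cpow hx2.le, Real.rpow_add hx2, ← pow_mul, ← Real.rpow_natCast,
    mul_comm]
  push_cast
  rfl

lemma besselJ_ofReal (hν : -1 < ν) {x : ℝ} (hx : 0 < x) :
    besselJ ν x =
      (((x / 2) ^ ν / Real.Gamma (ν + 1) * powSum (besselCoeff ν) (x ^ 2) : ℝ) : ℂ) := by
  have hG : Real.Gamma (ν + 1) ≠ 0 := (Real.Gamma_pos_of_pos (by linarith)).ne'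
  rw [besselJ, powSum, ← tsum_mul_left, Complex.ofReal_tsum]
  refine tsum_congr fun n => ?_
  rw [besselJ_term hx, ← Complex.ofReal_mul]
  congr 1
  have hG' : Real.Gamma (n + ν + 1) ≠ 0 := (Real.Gamma_pos_of_pos (natCast_add_pos hν n)).ne'
  have h4 : (x / 2) ^ 2 = x ^ 2 / 4 := by ring
  rw [besselCoeff, h4, div_pow]
  field_simp

lemma besselJ_add_one_ofReal (hν : -1 < ν) {x : ℝ} (hx : 0 < x) :
    besselJ (ν + 1) x = ((-2 * x * (x / 2) ^ ν / Real.Gamma (ν + 1) *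
      powSum (derivCoeff (besselCoeff ν)) (x ^ 2) : ℝ) : ℂ) := by
  have hG : Real.Gamma (ν + 1) ≠ 0 := (Real.Gamma_pos_of_pos (by linarith)).ne'
  rw [besselJ, powSum, ← tsum_mul_left, Complex.ofReal_tsum]
  refine tsum_congr fun n => ?_
  rw [besselJ_term hx, ← Complex.ofReal_mul]
  congr 1
  have hG' : Real.Gamma (((n + 1 : ℕ) : ℝ) + ν + 1) ≠ 0 :=
    (Real.Gamma_pos_of_pos (natCast_add_pos hν (n + 1))).ne'
  have e : (n : ℝ) + (ν + 1) + 1 = ((n + 1 : ℕ) : ℝ) + ν + 1 := by push_cast; ring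
  have h4 : (x / 2) ^ 2 = x ^ 2 / 4 := by ring
  have hf : (n.factorial : ℝ) ≠ 0 := by positivity
  have hn : (n : ℝ) + 1 ≠ 0 := by positivity
  rw [derivCoeff, besselCoeff, e, h4, div_pow, Real.rpow_add_one (by positivity),
    Nat.factorial_succ, Nat.cast_mul, Nat.cast_succ]
  rw [Nat.cast_succ] at hG'
  field_simp
  ring

lemma powSum_besselCoeff_pos (hν : -1 < ν)
    (hzero : ∀ x : ℝ, 0 < x → x ≤ 1 → besselJ ν (x : ℂ) ≠ 0) :
    ∀ x ∈ Set.Icc (0 : ℝ) 1, 0 < powSum (besselCoeff ν) x := by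
  have h := isEntireCoeff_besselCoeff hν
  have h0 : powSum (besselCoeff ν) 0 = 1 := by rw [powSum_zero, besselCoeff_zero hν]
  have hne : ∀ x ∈ Set.Icc (0 : ℝ) 1, powSum (besselCoeff ν) x ≠ 0 := by
    intro x hx hx0
    rcases hx.1.eq_or_lt with rfl | hxpos
    · rw [h0] at hx0
      exact one_ne_zero hx0
    · refine hzero (√x) (Real.sqrt_pos.2 hxpos) (Real.sqrt_le_one.2 hx.2) ?_
      rw [besselJ_ofReal hν (Real.sqrt_pos.2 hxpos), Real.sq_sqrt hx.1, hx0, mul_zero,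
        Complex.ofReal_zero]
  intro x hx
  by_contra! hneg
  obtain ⟨y, hy, hy0⟩ := intermediate_value_Icc' hx.1
    (f := powSum (besselCoeff ν)) (fun t _ => (h.hasDerivAt t).continuousAt.continuousWithinAt)
    ⟨hneg, by rw [h0]; exact zero_le_one⟩
  exact hne y ⟨hy.1, hy.2.trans hx.2⟩ hy0

end Bessel

/-- Let `ν > -1` be such that the first positive zero of `J_ν` exceeds `1`
(i.e. `J_ν` does not vanish on `(0,1]`).  Then the entire function
`g_ν(z) = 2^ν Γ(ν+1) z^(1-ν) J_ν(z)` has no zeros in the closed unit disk other than `0`,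
and for every `z ∈ 𝔻 \ {0}` one has
`Re (z g_ν'(z)/g_ν(z)) ≥ 1 - J_{ν+1}(1)/J_ν(1)`. -/
theorem re_g_quotient_lower_bound (ν : ℝ) (hν : -1 < ν)
    (hzero : ∀ x : ℝ, 0 < x → x ≤ 1 → besselJ ν (x : ℂ) ≠ 0) :
    (∀ z : ℂ, ‖z‖ ≤ 1 → besselG ν z = 0 → z = 0) ∧
      ∀ z ∈ Metric.ball (0 : ℂ) 1, z ≠ 0 →
        ((1 : ℂ) - besselJ (ν + 1) 1 / besselJ ν 1).re ≤
          (z * deriv (besselG ν) z / besselG ν z).re := by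
  have hpos := powSum_besselCoeff_pos hν hzero
  have hs := summable_rayleighCoeff hν hpos
  have hsq : ∀ z : ℂ, ‖z‖ ≤ 1 → ‖z ^ 2‖ ≤ 1 := fun z hz => by
    rw [norm_pow]
    exact pow_le_one₀ (norm_nonneg z) hz
  refine ⟨fun z hz hg => ?_, fun z hz hz0 => ?_⟩
  · rw [besselG_eq] at hg
    exact (mul_eq_zero.1 hg).resolve_right (powSum_besselCoeff_ne_zero hν hs (hsq z hz))
  have hz1 : ‖z‖ ≤ 1 := (mem_ball_zero_iff.1 hz).le
  have hw := hsq z hz1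
  have hf := powSum_besselCoeff_ne_zero hν hs hw
  have hf1 : powSum (besselCoeff ν) 1 ≠ 0 := (hpos 1 ⟨zero_le_one, le_rfl⟩).ne'
  have hratio : besselJ (ν + 1) 1 / besselJ ν 1 = ((2 * ∑' n, rayleighCoeff ν n : ℝ) : ℂ) := by
    have hG : Real.Gamma (ν + 1) ≠ 0 := (Real.Gamma_pos_of_pos (by linarith)).ne'
    have hp : ((1 : ℝ) / 2) ^ ν ≠ 0 := (Real.rpow_pos_of_pos (by norm_num) ν).ne'
    have hd : powSum (derivCoeff (besselCoeff ν)) 1 =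
        -((∑' n, rayleighCoeff ν n) * powSum (besselCoeff ν) 1) := by
      have h1 := powSum_derivCoeff_eq hν hs (w := ((1 : ℝ) : ℂ)) (by simp)
      rw [derivCoeff_ofReal, powSum_ofReal, powSum_ofReal, powSum_ofReal] at h1
      rw [show (∑' n, rayleighCoeff ν n) = powSum (rayleighCoeff ν) 1 by simp [powSum]]
      exact_mod_cast h1
    have h1 := besselJ_ofReal hν one_pos
    have h2 := besselJ_add_one_ofReal hν one_pos
    rw [Complex.ofReal_one] at h1 h2
    rw [h1, h2, one_pow, hd, ← Complex.ofReal_div]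
    congr 1
    field_simp
  have hquot : z * deriv (besselG ν) z / besselG ν z =
      1 - 2 * (z ^ 2 * powSum (fun n => (rayleighCoeff ν n : ℂ)) (z ^ 2)) := by
    rw [(hasDerivAt_besselG hν z).deriv, besselG_eq, powSum_derivCoeff_eq hν hs hw]
    field_simp
    ring
  have hbound : (z ^ 2 * powSum (fun n => (rayleighCoeff ν n : ℂ)) (z ^ 2)).re ≤
      ∑' n, rayleighCoeff ν n := by
    refine (Complex.re_le_norm _).trans ?_
    rw [norm_mul]
    exact (mul_le_of_le_one_left (norm_nonneg _) hw).trans (norm_powSum_rayleighCoeff_le hν hs hw)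
  rw [hratio, hquot, ← Complex.ofReal_one, ← Complex.ofReal_sub, Complex.ofReal_re]
  rw [Complex.sub_re, Complex.ofReal_re, ← Complex.ofReal_ofNat, Complex.re_ofReal_mul]
  linarith
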